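/- The splitting map st defined on generators by st(z^μ) = ζ^μ ⊗ U^μ, where ζ^μ are the commuting coordinate functions on R^{2n} and U^μ are the unitary generators of the noncommutative torus algebra A(T^n_θ) (satisfying U^μ U^ν = λ^{μν} U^ν U^μ), extends to a well-defined injective *-algebra homomorphism from A(R^{2n}_θ) into A(R^{2n}) ⊗ A(T^n_θ). -/

import Mathlib

open scoped TensorProduct

/-- The double of an algebra: `E × Eᵐᵒᵖ`, with conjugated scalars on the second factor. -/
def Dbl (E : Type) : Type := E × Eᵐᵒᵖ

namespace Dbl

instance instRing (E : Type) [Ring E] : Ring (Dbl E) := inferInstanceAs (Ring (E × Eᵐᵒᵖ))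

instance instCommRing (E : Type) [CommRing E] : CommRing (Dbl E) :=
  { instRing E with mul_comm := fun a b => mul_comm (G := E × Eᵐᵒᵖ) a b }

def mk {E : Type} (x y : E) : Dbl E := (x, MulOpposite.op y)
def fst {E : Type} (w : Dbl E) : E := Prod.fst w
def snd {E : Type} (w : Dbl E) : E := MulOpposite.unop (Prod.snd w)

theorem ext' {E : Type} {a b : Dbl E} (h : a.fst = b.fst) (h' : a.snd = b.snd) : a = b :=
  Prod.ext h (MulOpposite.unop_injective h')

section
variable {E : Type} [Ring E]
@[simp] theorem fst_mk (x y : E) : (mk x y).fst = x := rfl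
@[simp] theorem snd_mk (x y : E) : (mk x y).snd = y := rfl
@[simp] theorem fst_mul (a b : Dbl E) : (a * b).fst = a.fst * b.fst := rfl
@[simp] theorem snd_mul (a b : Dbl E) : (a * b).snd = b.snd * a.snd := rfl
@[simp] theorem fst_add (a b : Dbl E) : (a + b).fst = a.fst + b.fst := rfl
@[simp] theorem snd_add (a b : Dbl E) : (a + b).snd = a.snd + b.snd := rfl
@[simp] theorem fst_one : (1 : Dbl E).fst = 1 := rfl
@[simp] theorem snd_one : (1 : Dbl E).snd = 1 := rfl
@[simp] theorem fst_zero : (0 : Dbl E).fst = 0 := rfl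
@[simp] theorem snd_zero : (0 : Dbl E).snd = 0 := rfl

instance instStarRing : StarRing (Dbl E) where
  star w := mk w.snd w.fst
  star_involutive _ := rfl
  star_mul _ _ := rfl
  star_add _ _ := rfl

@[simp] theorem fst_star (a : Dbl E) : (star a).fst = a.snd := rfl
@[simp] theorem snd_star (a : Dbl E) : (star a).snd = a.fst := rfl

variable [Algebra ℂ E]

instance instAlgebra : Algebra ℂ (Dbl E) where
  smul c w := mk (c • w.fst) (star c • w.snd)
  algebraMap :=
    { toFun := fun c => mk (algebraMap ℂ E c) (algebraMap ℂ E (star c))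
      map_one' := by apply ext' <;> simp
      map_mul' := fun a b => by
        apply ext'
        · exact map_mul _ a b
        · change algebraMap ℂ E (star (a * b)) = _
          rw [star_mul]
          exact map_mul _ _ _
      map_zero' := by apply ext' <;> simp
      map_add' := fun a b => by apply ext' <;> simp }
  commutes' c w := by
    apply ext'
    · exact Algebra.commutes c w.fst
    · exact (Algebra.commutes (star c) w.snd).symm
  smul_def' c w := by
    apply ext'
    · exact Algebra.smul_def c w.fst
    · exact (Algebra.smul_def (star c) w.snd).trans (Algebra.commutes (star c) w.snd)

@[simp] theorem fst_smul (c : ℂ) (a : Dbl E) : (c • a).fst = c • a.fst := rfl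
@[simp] theorem snd_smul (c : ℂ) (a : Dbl E) : (c • a).snd = star c • a.snd := rfl

instance instStarModule : StarModule ℂ (Dbl E) where
  star_smul c a := by apply ext' <;> simp

/-- first projection as an algebra map -/
def fstHom : Dbl E →ₐ[ℂ] E where
  toFun := fst
  map_one' := rfl
  map_mul' _ _ := rfl
  map_zero' := rfl
  map_add' _ _ := rfl
  commutes' _ := rfl

@[simp] theorem fstHom_apply (a : Dbl E) : fstHom a = a.fst := rfl
end
end Dbl

/-- Proportionality of products over permuted words. -/
theorem perm_prod_smul {ι A : Type} [Ring A] [Algebra ℂ A] (g : ι → A)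
    (hg : ∀ i j, ∃ c : ℂ, g i * g j = c • (g j * g i)) {l l' : List ι} (h : l.Perm l') :
    ∃ c : ℂ, (l.map g).prod = c • (l'.map g).prod := by
  induction h with
  | nil => exact ⟨1, by simp⟩
  | cons x _ ih =>
    obtain ⟨c, hc⟩ := ih
    exact ⟨c, by simp [hc]⟩
  | swap x y l =>
    obtain ⟨c, hc⟩ := hg y x
    refine ⟨c, ?_⟩
    simp only [List.map_cons, List.prod_cons, ← mul_assoc, hc, smul_mul_assoc]
  | trans _ _ ih1 ih2 =>
    obtain ⟨c, hc⟩ := ih1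
    obtain ⟨d, hd⟩ := ih2
    exact ⟨c * d, by rw [hc, hd, mul_smul]⟩

/-- Words span. -/
theorem span_words {ι A : Type} [Ring A] [Algebra ℂ A] (g : ι → A)
    (hg : ∀ i j, ∃ c : ℂ, g i * g j = c • (g j * g i))
    (htop : Algebra.adjoin ℂ (Set.range g) = ⊤) (x : A) :
    ∃ p : Multiset ι →₀ ℂ, x = p.sum fun s c => c • (s.toList.map g).prod := by
  have hx : x ∈ Submodule.span ℂ (Set.range fun s : Multiset ι => (s.toList.map g).prod) := by
    have hx' : x ∈ Subalgebra.toSubmodule (Algebra.adjoin ℂ (Set.range g)) := by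
      rw [htop]; trivial
    rw [Algebra.adjoin_eq_span] at hx'
    refine (Submodule.span_le.2 ?_) hx'
    intro y hy
    obtain ⟨l, hl, rfl⟩ := Submonoid.exists_list_of_mem_closure hy
    have : ∃ l' : List ι, l'.map g = l := by
      clear hy
      induction l with
      | nil => exact ⟨[], rfl⟩
      | cons a l ih =>
        obtain ⟨i, hi⟩ := hl a (by simp)
        obtain ⟨l', hl'⟩ := ih (fun y hy => hl y (by simp [hy]))
        exact ⟨i :: l', by simp [hi, hl']⟩
    obtain ⟨l', rfl⟩ := this
    have hp : l'.Perm (l' : Multiset ι).toList := by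
      rw [← Multiset.coe_eq_coe, Multiset.coe_toList]
    obtain ⟨c, hc⟩ := perm_prod_smul g hg hp
    rw [hc]
    exact Submodule.smul_mem _ _ (Submodule.subset_span ⟨_, rfl⟩)
  rw [Finsupp.mem_span_range_iff_exists_finsupp] at hx
  obtain ⟨p, hp⟩ := hx
  exact ⟨p, hp.symm⟩

/-- shift operators -/
noncomputable def shiftOp {n : ℕ} (θ : Matrix (Fin n) (Fin n) ℝ) (μ : Fin n) :
    Module.End ℂ ((Fin n → ℝ) → ℂ) where
  toFun f := fun k => Complex.exp (-(Real.pi * Complex.I * ((θ.mulVec k) μ : ℝ))) *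
    f (k + Pi.single μ 1)
  map_add' f g := by ext k; simp [mul_add]
  map_smul' c f := by ext k; simp; ring

noncomputable def shiftInv {n : ℕ} (θ : Matrix (Fin n) (Fin n) ℝ) (μ : Fin n) :
    Module.End ℂ ((Fin n → ℝ) → ℂ) where
  toFun f := fun k => Complex.exp (Real.pi * Complex.I *
    ((θ.mulVec (k - Pi.single μ 1)) μ : ℝ)) * f (k - Pi.single μ 1)
  map_add' f g := by ext k; simp [mul_add]
  map_smul' c f := by ext k; simp; ring

theorem shift_inv {n : ℕ} (θ : Matrix (Fin n) (Fin n) ℝ) (μ : Fin n) :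
    shiftOp θ μ * shiftInv θ μ = 1 := by
  ext f k
  simp only [shiftOp, shiftInv, Module.End.mul_apply, LinearMap.coe_mk, AddHom.coe_mk,
    Module.End.one_apply, add_sub_cancel_right]
  rw [← mul_assoc, ← Complex.exp_add]
  simp

theorem inv_shift {n : ℕ} (θ : Matrix (Fin n) (Fin n) ℝ) (μ : Fin n) :
    shiftInv θ μ * shiftOp θ μ = 1 := by
  ext f k
  simp only [shiftOp, shiftInv, Module.End.mul_apply, LinearMap.coe_mk, AddHom.coe_mk,
    Module.End.one_apply, sub_add_cancel]
  rw [← mul_assoc, ← Complex.exp_add]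
  simp

theorem shift_rel {n : ℕ} (θ : Matrix (Fin n) (Fin n) ℝ) (hθ : Matrix.transpose θ = -θ)
    (μ ν : Fin n) :
    shiftOp θ μ * shiftOp θ ν =
      Complex.exp (2 * Real.pi * Complex.I * (θ μ ν)) • (shiftOp θ ν * shiftOp θ μ) := by
  have h : θ ν μ = - θ μ ν := by
    have := congrFun (congrFun hθ μ) ν
    simpa using this
  ext f k
  simp only [shiftOp, Module.End.mul_apply, LinearMap.coe_mk, AddHom.coe_mk,
    LinearMap.smul_apply, Pi.smul_apply, smul_eq_mul, Matrix.mulVec_add, Pi.add_apply,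
    Matrix.mulVec_single_one, Matrix.col_apply, h]
  rw [add_right_comm k (Pi.single ν 1)]
  simp only [← mul_assoc, ← Complex.exp_add]
  congr 2
  push_cast
  ring

/-- q-commutation passes to inverses. -/
theorem inv_rel {E : Type} [Ring E] [Algebra ℂ E] {u u' v : E} {c d : ℂ} (hdc : d * c = 1)
    (h1 : u' * u = 1) (h2 : u * u' = 1) (h : u * v = c • (v * u)) :
    u' * v = d • (v * u') := by
  have e : v * u = d • (u * v) := by rw [h, smul_smul, hdc, one_smul]
  calc u' * v = u' * (v * u) * u' := by rw [mul_assoc, mul_assoc, h2, mul_one]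
    _ = d • (u' * u * v * u') := by rw [e]; simp [mul_assoc]
    _ = d • (v * u') := by rw [h1, one_mul]

theorem list_prod_tmul {ι C T : Type} [CommRing C] [Algebra ℂ C] [Ring T] [Algebra ℂ T]
    (a : ι → C) (b : ι → T) (l : List ι) :
    (l.map fun i => a i ⊗ₜ[ℂ] b i).prod = (l.map a).prod ⊗ₜ[ℂ] (l.map b).prod := by
  induction l with
  | nil => rfl
  | cons i l ih => simp [ih]

/-- The splitting map st(z^μ) = ζ^μ ⊗ U^μ extends to a well-defined injective
*-algebra homomorphism from A(R^{2n}_θ) into A(R^{2n}) ⊗ A(T^n_θ). All three algebras are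
encoded by generators, relations and universal properties: A is A(R^{2n}_θ), C is the
commutative polynomial *-algebra A(R^{2n}) on ζ^μ, ζ̄^μ, and T is the noncommutative torus
A(T^n_θ) on unitaries U^μ. Star-compatibility of st is stated on generators (the tensor
product carries no canonical star in Mathlib). -/
theorem stmt2 (n : ℕ) (θ : Matrix (Fin n) (Fin n) ℝ) (hθ : Matrix.transpose θ = -θ)
    (lam : Fin n → Fin n → ℂ)
    (hlam : ∀ μ ν, lam μ ν = Complex.exp (2 * Real.pi * Complex.I * (θ μ ν)))
    -- the noncommutative plane A(R^{2n}_θ)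
    (A : Type) [Ring A] [Algebra ℂ A] [StarRing A] [StarModule ℂ A]
    (z : Fin n → A)
    (h1 : ∀ μ ν, z μ * z ν = lam μ ν • (z ν * z μ))
    (h2 : ∀ μ ν, star (z μ) * z ν = lam ν μ • (z ν * star (z μ)))
    (h3 : ∀ μ ν, star (z μ) * star (z ν) = lam μ ν • (star (z ν) * star (z μ)))
    (hAuniv : ∀ (B : Type) [Ring B] [Algebra ℂ B] [StarRing B] [StarModule ℂ B]
      (w : Fin n → B),
      (∀ μ ν, w μ * w ν = lam μ ν • (w ν * w μ)) →
      (∀ μ ν, star (w μ) * w ν = lam ν μ • (w ν * star (w μ))) →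
      (∀ μ ν, star (w μ) * star (w ν) = lam μ ν • (star (w ν) * star (w μ))) →
      ∃! f : A →⋆ₐ[ℂ] B, ∀ μ, f (z μ) = w μ)
    -- the commutative plane A(R^{2n}): free commutative *-algebra on ζ^μ
    (C : Type) [CommRing C] [Algebra ℂ C] [StarRing C] [StarModule ℂ C]
    (ζ : Fin n → C)
    (hCuniv : ∀ (B : Type) [CommRing B] [Algebra ℂ B] [StarRing B] [StarModule ℂ B]
      (w : Fin n → B), ∃! f : C →⋆ₐ[ℂ] B, ∀ μ, f (ζ μ) = w μ)
    -- the noncommutative torus A(T^n_θ)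
    (T : Type) [Ring T] [Algebra ℂ T] [StarRing T] [StarModule ℂ T]
    (U : Fin n → T)
    (hUunitary : ∀ μ, star (U μ) * U μ = 1 ∧ U μ * star (U μ) = 1)
    (hUrel : ∀ μ ν, U μ * U ν = lam μ ν • (U ν * U μ))
    (hTuniv : ∀ (B : Type) [Ring B] [Algebra ℂ B] [StarRing B] [StarModule ℂ B]
      (V : Fin n → B), (∀ μ, star (V μ) * V μ = 1 ∧ V μ * star (V μ) = 1) →
      (∀ μ ν, V μ * V ν = lam μ ν • (V ν * V μ)) →
      ∃! f : T →⋆ₐ[ℂ] B, ∀ μ, f (U μ) = V μ) :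
    ∃ st : A →ₐ[ℂ] C ⊗[ℂ] T,
      Function.Injective st ∧
      (∀ μ, st (z μ) = ζ μ ⊗ₜ[ℂ] U μ) ∧
      (∀ μ, st (star (z μ)) = star (ζ μ) ⊗ₜ[ℂ] star (U μ)) := by
  classical
  have hanti : ∀ μ ν, θ ν μ = - θ μ ν := fun μ ν => by
    have := congrFun (congrFun hθ μ) ν
    simpa using this
  have hll : ∀ μ ν, lam μ ν * lam ν μ = 1 := fun μ ν => by
    rw [hlam, hlam, hanti μ ν, ← Complex.exp_add]
    simp
  have hstar : ∀ μ ν, star (lam μ ν) = lam ν μ := fun μ ν => by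
    rw [hlam, hlam, hanti μ ν, Complex.star_def, ← Complex.exp_conj]
    simp [Complex.conj_ofNat]
  -- algebraic universal property of A
  have hA : ∀ (E : Type) [Ring E] [Algebra ℂ E] (x y : Fin n → E),
      (∀ μ ν, x μ * x ν = lam μ ν • (x ν * x μ)) →
      (∀ μ ν, y μ * x ν = lam ν μ • (x ν * y μ)) →
      (∀ μ ν, y μ * y ν = lam μ ν • (y ν * y μ)) →
      ∃ f : A →ₐ[ℂ] E, (∀ μ, f (z μ) = x μ) ∧ ∀ μ, f (star (z μ)) = y μ := by
    intro E _ _ x y hxx hyx hyy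
    obtain ⟨f, hf, -⟩ := hAuniv (Dbl E) (fun μ => Dbl.mk (x μ) (y μ))
      (fun μ ν => by
        apply Dbl.ext'
        · simpa using hxx μ ν
        · rw [Dbl.snd_smul, hstar]; simpa using hyy ν μ)
      (fun μ ν => by
        apply Dbl.ext'
        · simpa using hyx μ ν
        · rw [Dbl.snd_smul, hstar]; simpa using hyx ν μ)
      (fun μ ν => by
        apply Dbl.ext'
        · simpa using hyy μ ν
        · rw [Dbl.snd_smul, hstar]; simpa using hxx ν μ)
    refine ⟨Dbl.fstHom.comp f.toAlgHom, fun μ => ?_, fun μ => ?_⟩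
    · simp [hf]
    · simp [map_star, hf]
  -- algebraic universal property of C
  have hC : ∃ f : C →ₐ[ℂ] MvPolynomial (Fin n ⊕ Fin n) ℂ,
      (∀ μ, f (ζ μ) = MvPolynomial.X (Sum.inl μ)) ∧
      ∀ μ, f (star (ζ μ)) = MvPolynomial.X (Sum.inr μ) := by
    obtain ⟨f, hf, -⟩ := hCuniv (Dbl (MvPolynomial (Fin n ⊕ Fin n) ℂ))
      (fun μ => Dbl.mk (MvPolynomial.X (Sum.inl μ)) (MvPolynomial.X (Sum.inr μ)))
    refine ⟨Dbl.fstHom.comp f.toAlgHom, fun μ => ?_, fun μ => ?_⟩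
    · simp [hf]
    · simp [map_star, hf]
  -- T is nontrivial
  have hT : Nontrivial T := by
    obtain ⟨f, hf, -⟩ := hTuniv (Dbl (Module.End ℂ ((Fin n → ℝ) → ℂ)))
      (fun μ => Dbl.mk (shiftOp θ μ) (shiftInv θ μ))
      (fun μ => ⟨by apply Dbl.ext' <;> simp [inv_shift], by apply Dbl.ext' <;> simp [shift_inv]⟩)
      (fun μ ν => by
        have hs : ∀ μ ν, shiftOp θ μ * shiftOp θ ν = lam μ ν • (shiftOp θ ν * shiftOp θ μ) :=
          fun μ ν => by rw [hlam]; exact shift_rel θ hθ μ ν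
        apply Dbl.ext'
        · simpa using hs μ ν
        · rw [Dbl.snd_smul, hstar]
          simp only [Dbl.snd_mul, Dbl.snd_mk]
          have e1 := inv_rel (hll μ ν) (inv_shift θ ν) (shift_inv θ ν) (hs ν μ)
          have e2 : shiftOp θ μ * shiftInv θ ν = lam ν μ • (shiftInv θ ν * shiftOp θ μ) := by
            rw [e1, smul_smul, hll, one_smul]
          have e3 := inv_rel (hll μ ν) (inv_shift θ μ) (shift_inv θ μ) e2
          rw [e3, smul_smul, hll, one_smul])
    exact (Dbl.fstHom.comp f.toAlgHom).toRingHom.domain_nontrivial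
  -- generators
  let g : Fin n ⊕ Fin n → A := Sum.elim z (fun μ => star (z μ))
  let gC : Fin n ⊕ Fin n → C := Sum.elim ζ (fun μ => star (ζ μ))
  let gT : Fin n ⊕ Fin n → T := Sum.elim U (fun μ => star (U μ))
  have hyx : ∀ μ ν, star (U μ) * U ν = lam ν μ • (U ν * star (U μ)) := fun μ ν =>
    inv_rel (hll ν μ) (hUunitary μ).1 (hUunitary μ).2 (hUrel μ ν)
  have hyy : ∀ μ ν, star (U μ) * star (U ν) = lam μ ν • (star (U ν) * star (U μ)) := fun μ ν => by
    rw [← star_mul, ← star_mul, hUrel ν μ, star_smul, hstar]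
  obtain ⟨st, hst, hst'⟩ := hA (C ⊗[ℂ] T) (fun μ => ζ μ ⊗ₜ[ℂ] U μ)
    (fun μ => star (ζ μ) ⊗ₜ[ℂ] star (U μ))
    (fun μ ν => by
      simp only [Algebra.TensorProduct.tmul_mul_tmul]
      rw [hUrel μ ν, mul_comm (ζ μ), TensorProduct.tmul_smul])
    (fun μ ν => by
      simp only [Algebra.TensorProduct.tmul_mul_tmul]
      rw [hyx μ ν, mul_comm (star (ζ μ)), TensorProduct.tmul_smul])
    (fun μ ν => by
      simp only [Algebra.TensorProduct.tmul_mul_tmul]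
      rw [hyy μ ν, mul_comm (star (ζ μ)), TensorProduct.tmul_smul])
  refine ⟨st, ?_, hst, hst'⟩
  have hstg : ∀ i, st (g i) = gC i ⊗ₜ[ℂ] gT i := by
    rintro (μ | μ)
    · exact hst μ
    · exact hst' μ
  have hg : ∀ i j, ∃ c : ℂ, g i * g j = c • (g j * g i) := by
    rintro (μ | μ) (ν | ν)
    · exact ⟨_, h1 μ ν⟩
    · refine ⟨lam ν μ, ?_⟩
      change z μ * star (z ν) = lam ν μ • (star (z ν) * z μ)
      rw [h2 ν μ, smul_smul, hll, one_smul]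
    · exact ⟨_, h2 μ ν⟩
    · exact ⟨_, h3 μ ν⟩
  have htop : Algebra.adjoin ℂ (Set.range g) = ⊤ := by
    let S : StarSubalgebra ℂ A := StarAlgebra.adjoin ℂ (Set.range z)
    have hzS : ∀ μ, z μ ∈ S := fun μ => StarAlgebra.subset_adjoin ℂ _ ⟨μ, rfl⟩
    obtain ⟨f, hf, -⟩ := hAuniv S (fun μ => ⟨z μ, hzS μ⟩)
      (fun μ ν => Subtype.ext (h1 μ ν)) (fun μ ν => Subtype.ext (h2 μ ν))
      (fun μ ν => Subtype.ext (h3 μ ν))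
    have hid : S.subtype.comp f = StarAlgHom.id ℂ A :=
      (hAuniv A z h1 h2 h3).unique (fun μ => by simp [hf]) (fun μ => by simp)
    rw [eq_top_iff]
    rintro x -
    have hx : x ∈ S := by
      have : S.subtype (f x) = x := DFunLike.congr_fun hid x
      rw [← this]
      exact (f x).2
    have hx' : x ∈ Algebra.adjoin ℂ (Set.range z ∪ star (Set.range z)) := hx
    refine Algebra.adjoin_mono ?_ hx'
    rintro y (⟨μ, rfl⟩ | ⟨μ, hμ⟩)
    · exact ⟨Sum.inl μ, rfl⟩
    · exact ⟨Sum.inr μ, by change star (z μ) = y; rw [hμ, star_star]⟩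
  have hunit : ∀ l : List (Fin n ⊕ Fin n), IsUnit (l.map gT).prod := by
    intro l
    induction l with
    | nil => simp
    | cons i l ih =>
      rw [List.map_cons, List.prod_cons]
      refine IsUnit.mul ?_ ih
      rcases i with μ | μ
      · exact ⟨⟨U μ, star (U μ), (hUunitary μ).2, (hUunitary μ).1⟩, rfl⟩
      · exact ⟨⟨star (U μ), U μ, (hUunitary μ).1, (hUunitary μ).2⟩, rfl⟩
  obtain ⟨F, hF, hF'⟩ := hC
  have hFg : ∀ i, F (gC i) = MvPolynomial.X i := by
    rintro (μ | μ)
    · exact hF μ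
    · exact hF' μ
  have hFl : ∀ l : List (Fin n ⊕ Fin n), F (l.map gC).prod =
      MvPolynomial.monomial (Multiset.toFinsupp (l : Multiset (Fin n ⊕ Fin n))) 1 := by
    intro l
    induction l with
    | nil => simp
    | cons i l ih =>
      rw [List.map_cons, List.prod_cons, map_mul, ih, hFg, MvPolynomial.X,
        MvPolynomial.monomial_mul, ← Multiset.cons_coe, ← Multiset.singleton_add, map_add,
        Multiset.toFinsupp_singleton, one_mul]
  rw [injective_iff_map_eq_zero]
  intro x hx
  obtain ⟨p, rfl⟩ := span_words g hg htop x
  suffices hp : p = 0 by simp [hp]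
  ext s
  let φ : C →ₗ[ℂ] ℂ := (MvPolynomial.lcoeff ℂ (Multiset.toFinsupp s)).comp F.toLinearMap
  let Φ : C ⊗[ℂ] T →ₗ[ℂ] T := (TensorProduct.lid ℂ T).toLinearMap.comp (φ.rTensor T)
  have hword : ∀ t : Multiset (Fin n ⊕ Fin n), Φ (st (t.toList.map g).prod) =
      if t = s then (t.toList.map gT).prod else 0 := by
    intro t
    have e : st (t.toList.map g).prod =
        (t.toList.map gC).prod ⊗ₜ[ℂ] (t.toList.map gT).prod := by
      rw [map_list_prod, List.map_map, ← list_prod_tmul]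
      congr 2
      funext i
      exact hstg i
    have e2 : φ (t.toList.map gC).prod = if t = s then 1 else 0 := by
      change MvPolynomial.coeff _ (F _) = _
      rw [hFl, Multiset.coe_toList, MvPolynomial.coeff_monomial]
      simp
    rw [e]
    simp only [Φ, LinearMap.comp_apply, LinearEquiv.coe_coe]
    rw [LinearMap.rTensor_tmul, TensorProduct.lid_tmul, e2]
    split_ifs <;> simp
  have h0 := congrArg Φ hx
  rw [map_zero, Finsupp.sum, map_sum, map_sum] at h0
  simp only [map_smul, hword, smul_ite, smul_zero, Finset.sum_ite_eq'] at h0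
  by_contra hne
  rw [if_pos (Finsupp.mem_support_iff.2 hne)] at h0
  rcases smul_eq_zero.1 h0 with h | h
  · exact hne h
  · exact (hunit s.toList).ne_zero h
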